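/- Let a > 1. For every R > 0 there exists a constant c > 0 such that for every even Schwartz function F : ℝ → ℂ: ∫_0^R sup_{0 < t < 1} | ∫_0^∞ (sin(λ s)/(λ sinh s)) e^{i t λ^{a}} F(λ) λ² dλ | sinh²(s) ds ≤ c ( ∫_0^∞ (1 + λ²)^{1/4} |F(λ)|² λ² dλ )^{1/2}. -/

import Mathlib

open MeasureTheory
open scoped ENNReal NNReal SchwartzMap

/-- First-derivative van der Corput estimate for a phase with nowhere vanishing monotone
derivative. -/
theorem norm_integral_exp_phase_le {φ ψ ψ' : ℝ → ℝ} {A B m : ℝ} (hAB : A ≤ B) (hm : 0 < m)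
    (hφ : ∀ y ∈ Set.Icc A B, HasDerivAt φ (ψ y) y)
    (hψ : ∀ y ∈ Set.Icc A B, HasDerivAt ψ (ψ' y) y)
    (hc : ContinuousOn ψ' (Set.Icc A B))
    (hs : (∀ y ∈ Set.Icc A B, 0 ≤ ψ' y) ∨ (∀ y ∈ Set.Icc A B, ψ' y ≤ 0))
    (hlow : ∀ y ∈ Set.Icc A B, m ≤ |ψ y|) :
    ‖∫ y in A..B, Complex.exp (Complex.I * (φ y : ℂ))‖ ≤ 4 / m := by
  have hI : Set.uIcc A B = Set.Icc A B := Set.uIcc_of_le hAB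
  have hne : ∀ y ∈ Set.Icc A B, ψ y ≠ 0 := fun y hy => abs_pos.mp (hm.trans_le (hlow y hy))
  have hψc : ContinuousOn ψ (Set.Icc A B) := fun y hy => (hψ y hy).continuousAt.continuousWithinAt
  have hφc : ContinuousOn φ (Set.Icc A B) := fun y hy => (hφ y hy).continuousAt.continuousWithinAt
  set e : ℝ → ℂ := fun y => Complex.exp (Complex.I * (φ y : ℂ)) with he
  have hec : ContinuousOn e (Set.Icc A B) :=
    (continuousOn_const.mul (Complex.continuous_ofReal.comp_continuousOn hφc)).cexp
  have hnorm : ∀ y, ‖e y‖ = 1 := fun y => by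
    simp [he, mul_comm Complex.I, Complex.norm_exp_ofReal_mul_I]
  have hed : ∀ y ∈ Set.Icc A B, HasDerivAt e (Complex.I * (ψ y : ℂ) * e y) y := fun y hy => by
    have h := (((hφ y hy).ofReal_comp).const_mul Complex.I).cexp
    convert h using 1
    simp only [he]; ring
  set g : ℝ → ℝ := fun y => (ψ y)⁻¹ with hg
  set g' : ℝ → ℝ := fun y => -ψ' y / ψ y ^ 2 with hg'
  have hgd : ∀ y ∈ Set.Icc A B, HasDerivAt g (g' y) y := fun y hy => (hψ y hy).inv (hne y hy)
  have hgc' : ContinuousOn g' (Set.Icc A B) :=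
    hc.neg.div (hψc.pow 2) fun y hy => pow_ne_zero 2 (hne y hy)
  have hgi : IntervalIntegrable g' volume A B := (hI ▸ hgc').intervalIntegrable
  have hgb : ∀ y ∈ Set.Icc A B, |g y| ≤ 1 / m := fun y hy => by
    rw [hg, abs_inv, ← one_div]; exact one_div_le_one_div_of_le hm (hlow y hy)
  have hAm : A ∈ Set.Icc A B := Set.left_mem_Icc.mpr hAB
  have hBm : B ∈ Set.Icc A B := Set.right_mem_Icc.mpr hAB
  have hgint : ∫ y in A..B, g' y = g B - g A :=
    intervalIntegral.integral_eq_sub_of_hasDerivAt (fun y hy => hgd y (hI ▸ hy)) hgi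
  have hvar : ∫ y in A..B, |g' y| ≤ 2 / m := by
    have hsub : |g B - g A| ≤ 2 / m := by
      calc |g B - g A| ≤ |g B| + |g A| := abs_sub _ _
        _ ≤ 1 / m + 1 / m := add_le_add (hgb B hBm) (hgb A hAm)
        _ = 2 / m := by ring
    rcases hs with hs | hs
    · have : ∫ y in A..B, |g' y| = ∫ y in A..B, -g' y := by
        refine intervalIntegral.integral_congr fun y hy => abs_of_nonpos ?_
        exact div_nonpos_of_nonpos_of_nonneg (neg_nonpos.mpr (hs y (hI ▸ hy))) (sq_nonneg _)
      rw [this, intervalIntegral.integral_neg, hgint]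
      exact (neg_le_abs _).trans hsub
    · have : ∫ y in A..B, |g' y| = ∫ y in A..B, g' y := by
        refine intervalIntegral.integral_congr fun y hy => abs_of_nonneg ?_
        exact div_nonneg (neg_nonneg.mpr (hs y (hI ▸ hy))) (sq_nonneg _)
      rw [this, hgint]
      exact (le_abs_self _).trans hsub
  have hparts := intervalIntegral.integral_mul_deriv_eq_deriv_mul (a := A) (b := B)
    (u := fun y => (g y : ℂ)) (u' := fun y => (g' y : ℂ)) (v := e)
    (v' := fun y => Complex.I * (ψ y : ℂ) * e y)
    (fun y hy => (hgd y (hI ▸ hy)).ofReal_comp) (fun y hy => hed y (hI ▸ hy))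
    (ContinuousOn.intervalIntegrable (hI ▸ Complex.continuous_ofReal.comp_continuousOn hgc'))
    (ContinuousOn.intervalIntegrable (hI ▸ (continuousOn_const.mul
      (Complex.continuous_ofReal.comp_continuousOn hψc)).mul hec))
  have hleft : ∫ y in A..B, (g y : ℂ) * (Complex.I * (ψ y : ℂ) * e y) =
      Complex.I * ∫ y in A..B, e y := by
    rw [← intervalIntegral.integral_const_mul]
    refine intervalIntegral.integral_congr fun y hy => ?_
    have : (ψ y : ℂ) ≠ 0 := Complex.ofReal_ne_zero.mpr (hne y (hI ▸ hy))
    simp only [hg, Complex.ofReal_inv]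
    field_simp
  have hnn : ‖∫ y in A..B, e y‖ = ‖Complex.I * ∫ y in A..B, e y‖ := by simp
  have h3 : ‖∫ y in A..B, (g' y : ℂ) * e y‖ ≤ 2 / m := by
    refine (intervalIntegral.norm_integral_le_integral_norm hAB).trans (le_trans (le_of_eq ?_) hvar)
    refine intervalIntegral.integral_congr fun y _ => ?_
    simp [hnorm]
  rw [hnn, ← hleft, hparts]
  calc ‖(g B : ℂ) * e B - (g A : ℂ) * e A - ∫ y in A..B, (g' y : ℂ) * e y‖
      ≤ ‖(g B : ℂ) * e B‖ + ‖(g A : ℂ) * e A‖ + ‖∫ y in A..B, (g' y : ℂ) * e y‖ :=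
        (norm_sub_le _ _).trans (add_le_add_left (norm_sub_le _ _) _)
    _ ≤ 1 / m + 1 / m + 2 / m := by
        gcongr
        · simpa [hnorm] using hgb B hBm
        · simpa [hnorm] using hgb A hAm
    _ = 4 / m := by ring

theorem norm_integral_exp_phase_le_length (φ : ℝ → ℝ) {A B : ℝ} (hAB : A ≤ B) :
    ‖∫ y in A..B, Complex.exp (Complex.I * (φ y : ℂ))‖ ≤ B - A := by
  have := intervalIntegral.norm_integral_le_of_norm_le_const (a := A) (b := B) (C := 1)
    (f := fun y => Complex.exp (Complex.I * (φ y : ℂ)))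
    (fun y _ => by simp [mul_comm Complex.I, Complex.norm_exp_ofReal_mul_I])
  rwa [one_mul, abs_of_nonneg (sub_nonneg.mpr hAB)] at this

/-- Pointwise lower bound behind the non-stationary estimates. -/
theorem mul_abs_sub_one_le_mul_abs_rpow_sub_one {k r : ℝ} (hk : 0 < k) (hr : 0 < r) :
    k * min 1 (r ^ (k + 1)) * |r - 1| ≤ r * |r ^ k - 1| := by
  have hadd : r ^ (k + 1) = r * r ^ k := by rw [Real.rpow_add hr, Real.rpow_one, mul_comm]
  rcases le_total 1 r with h1 | h1
  · have hb := one_add_mul_self_le_rpow_one_add (s := r - 1) (by linarith) (p := k + 1)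
      (by linarith)
    rw [add_sub_cancel, hadd] at hb
    have hrk : 1 ≤ r ^ k := Real.one_le_rpow h1 hk.le
    rw [abs_of_nonneg (by linarith), abs_of_nonneg (by linarith)]
    have : k * min 1 (r ^ (k + 1)) * (r - 1) ≤ k * (r - 1) := by
      have := min_le_left 1 (r ^ (k + 1))
      have : k * min 1 (r ^ (k + 1)) ≤ k * 1 := by gcongr
      nlinarith
    nlinarith
  · have hb := one_add_mul_self_le_rpow_one_add (s := r⁻¹ - 1)
      (by have := inv_pos.mpr hr; linarith) (p := k + 1) (by linarith)
    have hrk0 : 0 < r ^ (k + 1) := Real.rpow_pos_of_pos hr _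
    rw [add_sub_cancel, Real.inv_rpow hr.le, ← one_div, ← one_div, le_div_iff₀ hrk0] at hb
    have hrk : r ^ k ≤ 1 := Real.rpow_le_one hr.le h1 hk.le
    have hexp : (1 + (k + 1) * (1 / r - 1)) * r ^ (k + 1) =
        r ^ (k + 1) + (k + 1) * (r ^ k - r ^ (k + 1)) := by
      rw [hadd]; field_simp
    rw [hexp, hadd] at hb
    rw [abs_of_nonpos (by linarith), abs_of_nonpos (by linarith), hadd]
    have h2 : k * min 1 (r * r ^ k) * -(r - 1) ≤ k * (r * r ^ k) * -(r - 1) := by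
      have := min_le_right 1 (r * r ^ k)
      gcongr
      linarith
    have h3 : k * r ^ k * (1 - r) ≤ 1 - r ^ k := by nlinarith
    nlinarith

/-- The van der Corput estimate for the phase `y² + t y^(k+2)` on an interval of positive reals. -/
theorem norm_integral_exp_sq_add_rpow_le_of_le {k t A B m : ℝ} (hA : 0 < A) (hAB : A ≤ B)
    (hm : 0 < m)
    (hs : (∀ y ∈ Set.Icc A B, 0 ≤ 2 + t * (k + 2) * (k + 1) * y ^ k) ∨
      (∀ y ∈ Set.Icc A B, 2 + t * (k + 2) * (k + 1) * y ^ k ≤ 0))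
    (hlow : ∀ y ∈ Set.Icc A B, m ≤ |2 * y + t * (k + 2) * y ^ (k + 1)|) :
    ‖∫ y in A..B, Complex.exp (Complex.I * ((y ^ 2 + t * y ^ (k + 2) : ℝ) : ℂ))‖ ≤ 4 / m := by
  have hpos : ∀ y ∈ Set.Icc A B, y ≠ 0 := fun y hy => (hA.trans_le hy.1).ne'
  refine norm_integral_exp_phase_le hAB hm (fun y hy => ?_) (fun y hy => ?_) ?_ hs hlow
  · have h := (hasDerivAt_pow 2 y).add
      ((Real.hasDerivAt_rpow_const (p := k + 2) (Or.inl (hpos y hy))).const_mul t)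
    exact h.congr_deriv (by rw [show k + 2 - 1 = k + 1 by ring]; push_cast; ring)
  · have h := ((hasDerivAt_id y).const_mul 2).add
      ((Real.hasDerivAt_rpow_const (p := k + 1) (Or.inl (hpos y hy))).const_mul (t * (k + 2)))
    exact h.congr_deriv (by rw [show k + 1 - 1 = k by ring]; ring)
  · exact continuousOn_const.add (continuousOn_const.mul
      (continuousOn_id.rpow_const fun y hy => Or.inl (hpos y hy)))

theorem continuous_exp_sq_add_rpow {k : ℝ} (hk : 0 < k) (x t : ℝ) :
    Continuous fun y : ℝ => Complex.exp (Complex.I * ((x * y ^ 2 + t * y ^ (k + 2) : ℝ) : ℂ)) := by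
  have : Continuous fun y : ℝ => y ^ (k + 2) :=
    Real.continuous_rpow_const (by linarith)
  fun_prop

theorem max_min_le_of_lt {u N v : ℝ} (h : u < max u (min N v)) : max u (min N v) ≤ v := by
  rcases lt_max_iff.mp h with h | h
  · exact absurd h (lt_irrefl u)
  · rw [max_eq_right h.le]; exact min_le_right _ _

theorem le_max_min_of_lt {u N v : ℝ} (h : max u (min N v) < N) : v ≤ max u (min N v) := by
  rcases min_lt_iff.mp (max_lt_iff.mp h).2 with h' | h'
  · exact absurd h' (lt_irrefl N)
  · rw [min_eq_right h'.le]; exact le_max_right _ _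

/-- Oscillatory integrals with phase `y² + t y^(k+2)`, where `t < 0`, are bounded uniformly in
`t`. -/
theorem exists_norm_integral_exp_sq_add_neg_rpow_le {k : ℝ} (hk : 0 < k) :
    ∃ C : ℝ, ∀ t N : ℝ, t < 0 → 0 ≤ N →
      ‖∫ y in (0 : ℝ)..N, Complex.exp (Complex.I * ((y ^ 2 + t * y ^ (k + 2) : ℝ) : ℂ))‖ ≤ C := by
  set r₁ : ℝ := ((k + 1)⁻¹) ^ k⁻¹ with hr₁
  have hk1 : 0 < k + 1 := by linarith
  have hr₁0 : 0 < r₁ := Real.rpow_pos_of_pos (inv_pos.mpr hk1) _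
  have hr₁1 : r₁ ≤ 1 :=
    Real.rpow_le_one (inv_pos.mpr hk1).le (inv_le_one_of_one_le₀ (by linarith)) (inv_pos.mpr hk).le
  have hr₁k : r₁ ^ k = (k + 1)⁻¹ := by
    rw [hr₁, ← Real.rpow_mul (inv_pos.mpr hk1).le, inv_mul_cancel₀ hk.ne', Real.rpow_one]
  have hr₁e : 0 < r₁ ^ (k + 1) := Real.rpow_pos_of_pos hr₁0 _
  set m₁ : ℝ := 2 * (k / (k + 1)) with hm₁
  set m₂ : ℝ := 2 * (k * r₁ ^ (k + 1)) with hm₂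
  have hm₁0 : 0 < m₁ := by positivity
  have hm₂0 : 0 < m₂ := by positivity
  refine ⟨1 + 4 / m₁ + 4 / m₂ + 2 + 4 / m₂, fun t N ht hN => ?_⟩
  set p : ℝ := (2 / ((k + 2) * -t)) ^ k⁻¹ with hp
  have hq : 0 < 2 / ((k + 2) * -t) := by
    have := neg_pos.mpr ht
    positivity
  have hp0 : 0 < p := Real.rpow_pos_of_pos hq _
  have hpk : t * (k + 2) * p ^ k = -2 := by
    rw [hp, ← Real.rpow_mul hq.le, inv_mul_cancel₀ hk.ne', Real.rpow_one]
    have := ht.ne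
    field_simp
  have hrk : ∀ y : ℝ, 0 < y → t * (k + 2) * y ^ k = -2 * (y / p) ^ k := fun y hy => by
    rw [Real.div_rpow hy.le hp0.le, ← hpk]
    have := (Real.rpow_pos_of_pos hp0 k).ne'
    field_simp
  have hd1 : ∀ y : ℝ, 0 < y →
      2 * y + t * (k + 2) * y ^ (k + 1) = 2 * y * (1 - (y / p) ^ k) := fun y hy => by
    rw [Real.rpow_add hy, Real.rpow_one, ← mul_assoc, hrk y hy]; ring
  have hd2 : ∀ y : ℝ, 0 < y →
      2 + t * (k + 2) * (k + 1) * y ^ k = 2 * (1 - (k + 1) * (y / p) ^ k) := fun y hy => by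
    rw [mul_right_comm, hrk y hy]; ring
  set E : ℝ → ℂ := fun y => Complex.exp (Complex.I * ((y ^ 2 + t * y ^ (k + 2) : ℝ) : ℂ)) with hE
  have hEi : ∀ A B : ℝ, IntervalIntegrable E volume A B := fun A B => by
    have := continuous_exp_sq_add_rpow hk 1 t
    simp only [one_mul] at this
    exact this.intervalIntegrable _ _
  have rising : ∀ A B : ℝ, 1 ≤ A → A ≤ B → B ≤ p * r₁ → ‖∫ y in A..B, E y‖ ≤ 4 / m₁ := by
    intro A B hA hAB hB
    have hy0 : ∀ y ∈ Set.Icc A B, 0 < y := fun y hy => by linarith [hy.1]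
    have hsmall : ∀ y ∈ Set.Icc A B, (y / p) ^ k ≤ (k + 1)⁻¹ := fun y hy => by
      rw [← hr₁k]
      refine Real.rpow_le_rpow (div_nonneg (hy0 y hy).le hp0.le) ?_ hk.le
      rw [div_le_iff₀ hp0]; linarith [hy.2]
    refine norm_integral_exp_sq_add_rpow_le_of_le (by linarith) hAB hm₁0
      (Or.inl fun y hy => ?_) fun y hy => ?_
    · rw [hd2 y (hy0 y hy)]
      have := mul_le_mul_of_nonneg_left (hsmall y hy) hk1.le
      rw [mul_inv_cancel₀ hk1.ne'] at this
      linarith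
    · rw [hd1 y (hy0 y hy)]
      refine le_trans ?_ (le_abs_self _)
      have h1 : k / (k + 1) ≤ 1 - (y / p) ^ k := by
        have : k / (k + 1) = 1 - (k + 1)⁻¹ := by field_simp; ring
        linarith [hsmall y hy]
      have h2 : 0 < k / (k + 1) := by positivity
      have h3 : 1 ≤ y := hA.trans hy.1
      rw [hm₁]; nlinarith
  have falling : ∀ A B : ℝ, 0 < A → A ≤ B → p * r₁ ≤ A → (B ≤ p - 1 ∨ p + 1 ≤ A) →
      ‖∫ y in A..B, E y‖ ≤ 4 / m₂ := by
    intro A B hA hAB hA₁ hfar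
    have hy0 : ∀ y ∈ Set.Icc A B, 0 < y := fun y hy => by linarith [hy.1]
    have hbig : ∀ y ∈ Set.Icc A B, r₁ ≤ y / p := fun y hy => by
      rw [le_div_iff₀ hp0]; linarith [hy.1]
    refine norm_integral_exp_sq_add_rpow_le_of_le hA hAB hm₂0
      (Or.inr fun y hy => ?_) fun y hy => ?_
    · rw [hd2 y (hy0 y hy)]
      have h := Real.rpow_le_rpow hr₁0.le (hbig y hy) hk.le
      rw [hr₁k] at h
      have := mul_le_mul_of_nonneg_left h hk1.le
      rw [mul_inv_cancel₀ hk1.ne'] at this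
      linarith
    · have hr0 : 0 < y / p := hr₁0.trans_le (hbig y hy)
      have hmain := mul_abs_sub_one_le_mul_abs_rpow_sub_one hk hr0
      have hmin : r₁ ^ (k + 1) ≤ min 1 ((y / p) ^ (k + 1)) :=
        le_min (Real.rpow_le_one hr₁0.le hr₁1 hk1.le)
          (Real.rpow_le_rpow hr₁0.le (hbig y hy) hk1.le)
      have hdist : 1 ≤ p * |y / p - 1| := by
        rw [← abs_of_pos hp0, ← abs_mul, abs_of_pos hp0, mul_sub, mul_div_cancel₀ _ hp0.ne', mul_one]
        rcases hfar with h | h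
        · rw [abs_of_nonpos (by linarith [hy.2])]; linarith [hy.2]
        · rw [abs_of_nonneg (by linarith [hy.1])]; linarith [hy.1]
      rw [hd1 y (hy0 y hy), abs_mul, abs_of_pos (by linarith [hy0 y hy]), abs_sub_comm, hm₂]
      have hyp : y = p * (y / p) := by field_simp
      calc 2 * (k * r₁ ^ (k + 1)) ≤ 2 * (k * r₁ ^ (k + 1)) * (p * |y / p - 1|) :=
            le_mul_of_one_le_right hm₂0.le hdist
        _ ≤ 2 * (k * min 1 ((y / p) ^ (k + 1))) * (p * |y / p - 1|) := by gcongr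
        _ = 2 * p * (k * min 1 ((y / p) ^ (k + 1)) * |y / p - 1|) := by ring
        _ ≤ 2 * p * (y / p * |(y / p) ^ k - 1|) := by gcongr
        _ = 2 * y * |(y / p) ^ k - 1| := by field_simp
  set q₁ := min 1 N with hq₁
  set q₂ := max q₁ (min N (p * r₁)) with hq₂
  set q₃ := max q₂ (min N (p - 1)) with hq₃
  set q₄ := max q₃ (min N (p + 1)) with hq₄
  have h01 : 0 ≤ q₁ := le_min zero_le_one hN
  have h12 : q₁ ≤ q₂ := le_max_left _ _
  have h23 : q₂ ≤ q₃ := le_max_left _ _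
  have h34 : q₃ ≤ q₄ := le_max_left _ _
  have h1N : q₁ ≤ N := min_le_right _ _
  have h2N : q₂ ≤ N := max_le h1N (min_le_left _ _)
  have h3N : q₃ ≤ N := max_le h2N (min_le_left _ _)
  have h4N : q₄ ≤ N := max_le h3N (min_le_left _ _)
  have one_le : q₁ < N → q₁ = 1 := fun h => by
    rcases min_lt_iff.mp h with h' | h'
    · exact min_eq_left h'.le
    · exact absurd h' (lt_irrefl N)
  have I1 : ‖∫ y in (0 : ℝ)..q₁, E y‖ ≤ 1 :=
    (norm_integral_exp_phase_le_length _ h01).trans (by linarith [min_le_left 1 N])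
  have I2 : ‖∫ y in q₁..q₂, E y‖ ≤ 4 / m₁ := by
    rcases h12.eq_or_lt with h | h
    · rw [← h, intervalIntegral.integral_same, norm_zero]; positivity
    · exact rising _ _ (one_le (h.trans_le h2N)).ge h12 (max_min_le_of_lt h)
  have I3 : ‖∫ y in q₂..q₃, E y‖ ≤ 4 / m₂ := by
    rcases h23.eq_or_lt with h | h
    · rw [← h, intervalIntegral.integral_same, norm_zero]; positivity
    · have := one_le (h12.trans_lt (h.trans_le h3N))
      exact falling _ _ (by linarith) h23 (le_max_min_of_lt (h.trans_le h3N))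
        (Or.inl (max_min_le_of_lt h))
  have I4 : ‖∫ y in q₃..q₄, E y‖ ≤ 2 := by
    refine (norm_integral_exp_phase_le_length _ h34).trans ?_
    rcases h34.eq_or_lt with h | h
    · linarith
    · have h4 : q₄ ≤ p + 1 := max_min_le_of_lt h
      have h3 : p - 1 ≤ q₃ := le_max_min_of_lt (h.trans_le h4N)
      linarith
  have I5 : ‖∫ y in q₄..N, E y‖ ≤ 4 / m₂ := by
    rcases h4N.eq_or_lt with h | h
    · rw [h, intervalIntegral.integral_same, norm_zero]; positivity
    · have h1 := one_le (by linarith)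
      have h4 : p + 1 ≤ q₄ := le_max_min_of_lt h
      have : p * r₁ ≤ p := mul_le_of_le_one_right hp0.le hr₁1
      exact falling _ _ (by linarith) h4N (by linarith) (Or.inr h4)
  rw [← intervalIntegral.integral_add_adjacent_intervals (hEi 0 q₄) (hEi q₄ N),
    ← intervalIntegral.integral_add_adjacent_intervals (hEi 0 q₃) (hEi q₃ q₄),
    ← intervalIntegral.integral_add_adjacent_intervals (hEi 0 q₂) (hEi q₂ q₃),
    ← intervalIntegral.integral_add_adjacent_intervals (hEi 0 q₁) (hEi q₁ q₂)]
  exact norm_add_le_of_le (norm_add_le_of_le (norm_add_le_of_le (norm_add_le_of_le I1 I2) I3) I4) I5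

theorem norm_integral_exp_sq_add_nonneg_rpow_le {k t N : ℝ} (hk : 0 < k) (ht : 0 ≤ t)
    (hN : 0 ≤ N) :
    ‖∫ y in (0 : ℝ)..N, Complex.exp (Complex.I * ((y ^ 2 + t * y ^ (k + 2) : ℝ) : ℂ))‖ ≤ 3 := by
  set E : ℝ → ℂ := fun y => Complex.exp (Complex.I * ((y ^ 2 + t * y ^ (k + 2) : ℝ) : ℂ)) with hE
  have hEi : ∀ A B : ℝ, IntervalIntegrable E volume A B := fun A B => by
    have := continuous_exp_sq_add_rpow hk 1 t
    simp only [one_mul] at this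
    exact this.intervalIntegrable _ _
  rcases le_total N 1 with h1 | h1
  · exact (norm_integral_exp_phase_le_length _ hN).trans (by linarith)
  have I1 : ‖∫ y in (0 : ℝ)..1, E y‖ ≤ 1 :=
    (norm_integral_exp_phase_le_length _ zero_le_one).trans (by norm_num)
  have I2 : ‖∫ y in (1 : ℝ)..N, E y‖ ≤ 4 / 2 := by
    refine norm_integral_exp_sq_add_rpow_le_of_le one_pos h1 two_pos
      (Or.inl fun y hy => ?_) fun y hy => ?_
    · have : 0 ≤ y := by linarith [hy.1]
      positivity
    · have : 0 ≤ y := by linarith [hy.1]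
      refine le_trans ?_ (le_abs_self _)
      have : 0 ≤ t * (k + 2) * y ^ (k + 1) := by positivity
      linarith [hy.1]
  rw [← intervalIntegral.integral_add_adjacent_intervals (hEi 0 1) (hEi 1 N)]
  exact (norm_add_le_of_le I1 I2).trans (by norm_num)

/-- Oscillatory integrals with phase `x y² + t y^(k+2)` are `O(|x|^(-1/2))`, uniformly in `t`
and in the length of the interval. -/
theorem exists_norm_integral_exp_mul_sq_add_rpow_le {k : ℝ} (hk : 0 < k) :
    ∃ C : ℝ, 0 < C ∧ ∀ x t N : ℝ, x ≠ 0 → 0 ≤ N →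
      ‖∫ y in (0 : ℝ)..N, Complex.exp (Complex.I * ((x * y ^ 2 + t * y ^ (k + 2) : ℝ) : ℂ))‖
        ≤ C * |x| ^ (-(1 / 2) : ℝ) := by
  obtain ⟨C₀, hC₀⟩ := exists_norm_integral_exp_sq_add_neg_rpow_le hk
  have unit : ∀ t N : ℝ, 0 ≤ N →
      ‖∫ y in (0 : ℝ)..N, Complex.exp (Complex.I * ((y ^ 2 + t * y ^ (k + 2) : ℝ) : ℂ))‖
        ≤ max C₀ 3 := fun t N hN => by
    rcases lt_or_ge t 0 with ht | ht
    · exact (hC₀ t N ht hN).trans (le_max_left _ _)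
    · exact (norm_integral_exp_sq_add_nonneg_rpow_le hk ht hN).trans (le_max_right _ _)
  have pos : ∀ x t N : ℝ, 0 < x → 0 ≤ N →
      ‖∫ y in (0 : ℝ)..N, Complex.exp (Complex.I * ((x * y ^ 2 + t * y ^ (k + 2) : ℝ) : ℂ))‖
        ≤ max C₀ 3 * x ^ (-(1 / 2) : ℝ) := fun x t N hx hN => by
    set c : ℝ := x ^ (1 / 2 : ℝ) with hc
    have hc0 : 0 < c := Real.rpow_pos_of_pos hx _
    have hc2 : c ^ 2 = x := by
      rw [hc, ← Real.rpow_natCast, ← Real.rpow_mul hx.le]; norm_num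
    have hscale := intervalIntegral.integral_comp_mul_left (a := 0) (b := N) (c := c)
      (fun y : ℝ => Complex.exp (Complex.I *
        ((y ^ 2 + t / c ^ (k + 2) * y ^ (k + 2) : ℝ) : ℂ))) hc0.ne'
    have hcongr : ∫ y in (0 : ℝ)..N,
        Complex.exp (Complex.I * ((x * y ^ 2 + t * y ^ (k + 2) : ℝ) : ℂ)) =
        ∫ y in (0 : ℝ)..N, Complex.exp (Complex.I *
          (((c * y) ^ 2 + t / c ^ (k + 2) * (c * y) ^ (k + 2) : ℝ) : ℂ)) := by
      refine intervalIntegral.integral_congr fun y hy => ?_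
      rw [Set.uIcc_of_le hN] at hy
      have : (c ^ (k + 2)) ≠ 0 := (Real.rpow_pos_of_pos hc0 _).ne'
      have e : (c * y) ^ 2 + t / c ^ (k + 2) * (c * y) ^ (k + 2) =
          x * y ^ 2 + t * y ^ (k + 2) := by
        rw [Real.mul_rpow hc0.le hy.1, mul_pow, hc2]; field_simp
      simp only [e]
    rw [hcongr, hscale, norm_smul, Real.rpow_neg hx.le, ← hc, norm_inv, Real.norm_of_nonneg hc0.le,
      mul_zero, mul_comm]
    gcongr
    exact unit _ _ (by positivity)
  refine ⟨max C₀ 3, by positivity, fun x t N hx hN => ?_⟩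
  rcases hx.lt_or_gt with h | h
  · rw [abs_of_neg h, ← Complex.norm_conj, ← intervalIntegral.intervalIntegral_conj]
    refine le_of_eq_of_le (congrArg norm (intervalIntegral.integral_congr fun y _ => ?_))
      (pos (-x) (-t) N (neg_pos.mpr h) hN)
    simp only [← Complex.exp_conj, map_mul, Complex.conj_I, Complex.conj_ofReal]
    congr 1
    push_cast
    ring
  · rw [abs_of_pos h]
    exact pos x t N h hN

theorem ofReal_integral_norm_sq_le_lintegral_kernel {X Y : Type*} [MeasurableSpace X]
    [MeasurableSpace Y] (α : Measure X) [IsFiniteMeasure α] (ν : Measure Y) [IsFiniteMeasure ν]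
    {e : X → Y → ℂ} (he : Measurable (Function.uncurry e)) (he1 : ∀ x y, ‖e x y‖ ≤ 1) :
    ENNReal.ofReal (∫ y, ‖∫ x, e x y ∂α‖ ^ 2 ∂ν) ≤
      ∫⁻ x, ∫⁻ x', ‖∫ y, e x y * (starRingEnd ℂ) (e x' y) ∂ν‖ₑ ∂α ∂α := by
  have hconj : Measurable (starRingEnd ℂ) := Complex.continuous_conj.measurable
  have hm : Measurable fun q : Y × (X × X) => e q.2.1 q.1 * (starRingEnd ℂ) (e q.2.2 q.1) :=
    (he.comp (measurable_snd.fst.prodMk measurable_fst)).mul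
      (hconj.comp (he.comp (measurable_snd.snd.prodMk measurable_fst)))
  have hm' : Measurable fun q : (X × X) × Y => e q.1.1 q.2 * (starRingEnd ℂ) (e q.1.2 q.2) :=
    hm.comp measurable_swap
  have hb : ∀ x x' y, ‖e x y * (starRingEnd ℂ) (e x' y)‖ ≤ 1 := fun x x' y => by
    rw [norm_mul, RCLike.norm_conj]
    exact mul_le_one₀ (he1 x y) (norm_nonneg _) (he1 x' y)
  have key : ((∫ y, ‖∫ x, e x y ∂α‖ ^ 2 ∂ν : ℝ) : ℂ) =
      ∫ p : X × X, (∫ y, e p.1 y * (starRingEnd ℂ) (e p.2 y) ∂ν) ∂(α.prod α) := by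
    have hint : Integrable (Function.uncurry fun (y : Y) (p : X × X) =>
        e p.1 y * (starRingEnd ℂ) (e p.2 y)) (ν.prod (α.prod α)) :=
      Integrable.of_bound hm.aestronglyMeasurable 1 (ae_of_all _ fun q => hb _ _ _)
    rw [← integral_integral_swap hint, ← integral_complex_ofReal]
    refine integral_congr_ae (ae_of_all _ fun y => ?_)
    simp only
    rw [integral_prod_mul (fun x => e x y) (fun x => (starRingEnd ℂ) (e x y)), integral_conj,
      Complex.mul_conj, Complex.normSq_eq_norm_sq]
  have hnn : 0 ≤ ∫ y, ‖∫ x, e x y ∂α‖ ^ 2 ∂ν := integral_nonneg fun y => sq_nonneg _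
  have h1 : ENNReal.ofReal (∫ y, ‖∫ x, e x y ∂α‖ ^ 2 ∂ν) =
      ‖((∫ y, ‖∫ x, e x y ∂α‖ ^ 2 ∂ν : ℝ) : ℂ)‖ₑ := by
    rw [← ofReal_norm, Complex.norm_real, Real.norm_of_nonneg hnn]
  rw [h1, key]
  refine (enorm_integral_le_lintegral_enorm _).trans (le_of_eq ?_)
  rw [lintegral_prod]
  exact (hm'.stronglyMeasurable.integral_prod_right').enorm.aemeasurable

/-- A `T T*` bound: an operator with bounded kernel `e` maps `L²` to `L¹` when the truncated kernels
of `T T*` have uniformly bounded total mass. -/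
theorem integral_norm_integral_mul_le_of_kernel {X : Type*} [MeasurableSpace X]
    (α : Measure X) [IsFiniteMeasure α] {e : X → ℝ → ℂ} (he : Measurable (Function.uncurry e))
    (he1 : ∀ x y, ‖e x y‖ ≤ 1) {H : ℝ → ℂ} (hHm : Measurable H)
    (hH : IntegrableOn H (Set.Ioi 0)) (hH2 : IntegrableOn (fun y => ‖H y‖ ^ 2) (Set.Ioi 0))
    {D : ℝ} (hD : 0 ≤ D)
    (hK : ∀ N : ℝ, 0 ≤ N → ∫⁻ x, ∫⁻ x',
      ‖∫ y in Set.Ioc 0 N, e x y * (starRingEnd ℂ) (e x' y)‖ₑ ∂α ∂α ≤ ENNReal.ofReal D) :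
    ∫ x, ‖∫ y in Set.Ioi (0 : ℝ), e x y * H y‖ ∂α ≤
      √D * √(∫ y in Set.Ioi (0 : ℝ), ‖H y‖ ^ 2) := by
  set T : X → ℂ := fun x => ∫ y in Set.Ioi (0 : ℝ), e x y * H y with hT
  have hconj : Measurable (starRingEnd ℂ) := Complex.continuous_conj.measurable
  have hTm : Measurable T := by
    have : Measurable fun q : X × ℝ => e q.1 q.2 * H q.2 := he.mul (hHm.comp measurable_snd)
    exact this.stronglyMeasurable.integral_prod_right'.measurable
  set w : X → ℂ := fun x => (starRingEnd ℂ) (T x) / (‖T x‖ : ℂ) with hw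
  have hwm : Measurable w := (hconj.comp hTm).div (Complex.measurable_ofReal.comp hTm.norm)
  have hw1 : ∀ x, ‖w x‖ ≤ 1 := fun x => by
    simp only [hw, norm_div, RCLike.norm_conj, Complex.norm_real, norm_norm]
    exact div_self_le_one _
  have hwT : ∀ x, w x * T x = (‖T x‖ : ℂ) := fun x => by
    simp only [hw]
    rcases eq_or_ne (T x) 0 with h | h
    · simp [h]
    · have : (‖T x‖ : ℂ) ≠ 0 := Complex.ofReal_ne_zero.mpr (norm_ne_zero_iff.mpr h)
      rw [div_mul_eq_mul_div, div_eq_iff this, mul_comm, Complex.mul_conj,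
        Complex.normSq_eq_norm_sq]
      push_cast; ring
  set f : X → ℝ → ℂ := fun x y => w x * e x y with hf
  have hfm : Measurable (Function.uncurry f) := (hwm.comp measurable_fst).mul he
  have hf1 : ∀ x y, ‖f x y‖ ≤ 1 := fun x y => by
    rw [hf, norm_mul]; exact mul_le_one₀ (hw1 x) (norm_nonneg _) (he1 x y)
  set Φ : ℝ → ℂ := fun y => ∫ x, f x y ∂α with hΦ
  have hΦm : Measurable Φ := (hfm.stronglyMeasurable.integral_prod_left').measurable
  have hΦb : ∀ y, ‖Φ y‖ ≤ α.real Set.univ := fun y => by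
    have := norm_integral_le_of_norm_le_const (μ := α) (f := fun x => f x y)
      (ae_of_all _ fun x => hf1 x y)
    simpa using this
  have hswap : ((∫ x, ‖T x‖ ∂α : ℝ) : ℂ) = ∫ y in Set.Ioi (0 : ℝ), Φ y * H y := by
    have hint : Integrable (Function.uncurry fun (x : X) (y : ℝ) => f x y * H y)
        (α.prod (volume.restrict (Set.Ioi (0 : ℝ)))) := by
      have hH' : Integrable (fun q : X × ℝ => H q.2) (α.prod (volume.restrict (Set.Ioi (0 : ℝ)))) :=
        hH.comp_snd α
      exact hH'.bdd_mul hfm.aestronglyMeasurable (ae_of_all _ fun q => hf1 q.1 q.2)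
    rw [← integral_complex_ofReal]
    calc ∫ x, (‖T x‖ : ℂ) ∂α = ∫ x, (∫ y in Set.Ioi (0 : ℝ), f x y * H y) ∂α := by
          refine integral_congr_ae (ae_of_all _ fun x => ?_)
          simp only [hf, mul_assoc, integral_const_mul]
          exact (hwT x).symm
      _ = ∫ y in Set.Ioi (0 : ℝ), (∫ x, f x y * H y ∂α) := integral_integral_swap hint
      _ = ∫ y in Set.Ioi (0 : ℝ), Φ y * H y := by
          simp only [hΦ, integral_mul_const]
  have hprod : IntegrableOn (fun y => ‖Φ y‖ * ‖H y‖) (Set.Ioi 0) :=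
    hH.norm.bdd_mul hΦm.norm.aestronglyMeasurable
      (c := α.real Set.univ) (ae_of_all _ fun y => by rw [norm_norm]; exact hΦb y)
  have hle : ∫ x, ‖T x‖ ∂α ≤ ∫ y in Set.Ioi (0 : ℝ), ‖Φ y‖ * ‖H y‖ := by
    have h0 : 0 ≤ ∫ x, ‖T x‖ ∂α := integral_nonneg fun x => norm_nonneg _
    rw [← Real.norm_of_nonneg h0, ← Complex.norm_real, hswap]
    refine (norm_integral_le_integral_norm _).trans (le_of_eq ?_)
    simp only [norm_mul]
  refine hle.trans (le_of_tendsto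
    (intervalIntegral_tendsto_integral_Ioi 0 hprod Filter.tendsto_id)
    (Filter.eventually_atTop.mpr ⟨0, fun N hN => ?_⟩))
  rw [id, intervalIntegral.integral_of_le hN]
  have hsub : Set.Ioc 0 N ⊆ Set.Ioi (0 : ℝ) := fun y hy => hy.1
  have hΦ2 : ∫ y in Set.Ioc 0 N, ‖Φ y‖ ^ 2 ≤ D := by
    rw [← ENNReal.ofReal_le_ofReal_iff hD]
    refine (ofReal_integral_norm_sq_le_lintegral_kernel α (volume.restrict (Set.Ioc 0 N))
      hfm hf1).trans (le_trans ?_ (hK N hN))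
    refine lintegral_mono fun x => lintegral_mono fun x' => ?_
    have : ∫ y in Set.Ioc 0 N, f x y * (starRingEnd ℂ) (f x' y) =
        w x * (starRingEnd ℂ) (w x') * ∫ y in Set.Ioc 0 N, e x y * (starRingEnd ℂ) (e x' y) := by
      rw [← integral_const_mul]
      refine integral_congr_ae (ae_of_all _ fun y => ?_)
      simp only [hf, map_mul]; ring
    simp only [this]
    rw [enorm_le_iff_norm_le, norm_mul, norm_mul, RCLike.norm_conj]
    exact mul_le_of_le_one_left (norm_nonneg _)
      (mul_le_one₀ (hw1 x) (norm_nonneg _) (hw1 x'))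
  have hCS := integral_mul_le_Lp_mul_Lq_of_nonneg (μ := volume.restrict (Set.Ioc 0 N))
    (f := fun y => ‖Φ y‖) (g := fun y => ‖H y‖) Real.HolderConjugate.two_two
    (ae_of_all _ fun y => norm_nonneg _) (ae_of_all _ fun y => norm_nonneg _)
    (by
      refine (MemLp.of_bound hΦm.norm.aestronglyMeasurable (α.real Set.univ)
        (ae_of_all _ fun y => ?_))
      rw [norm_norm]; exact hΦb y)
    (by
      rw [show ENNReal.ofReal 2 = 2 by norm_num,
        memLp_two_iff_integrable_sq hHm.norm.aestronglyMeasurable]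
      exact hH2.mono_set hsub)
  simp only [← Real.sqrt_eq_rpow, Real.rpow_two] at hCS
  refine hCS.trans ?_
  gcongr
  · exact ae_of_all _ fun y => sq_nonneg _

theorem intervalIntegrable_abs_rpow_neg_half (R : ℝ) :
    IntervalIntegrable (fun y : ℝ => |y| ^ (-(1 / 2) : ℝ)) volume (-R) R := by
  have h : ∀ x : ℝ, 0 < x → IntervalIntegrable (fun y : ℝ => |y| ^ (-(1 / 2) : ℝ)) volume 0 x := by
    intro x hx
    refine (intervalIntegral.intervalIntegrable_rpow' (a := 0) (b := x) (r := -(1 / 2))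
      (by norm_num)).congr fun y hy => ?_
    rw [Set.uIoc_of_le hx.le] at hy
    simp only [abs_of_pos hy.1]
  exact intervalIntegrable_of_even (fun y => by simp) h (by simp) (by simp)

/-- Linearized maximal estimate: `τ` is an arbitrary measurable choice of times. -/
theorem exists_integral_norm_linearized_le {k R : ℝ} (hk : 0 < k) :
    ∃ D : ℝ, 0 ≤ D ∧ ∀ σ : ℝ, |σ| = 1 → ∀ τ : ℝ → ℝ, Measurable τ → ∀ H : ℝ → ℂ, Measurable H →
      IntegrableOn H (Set.Ioi 0) → IntegrableOn (fun y => ‖H y‖ ^ 2) (Set.Ioi 0) →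
      ∫ s in Set.Ioc 0 R, ‖∫ y in Set.Ioi (0 : ℝ),
        Complex.exp (Complex.I * ((σ * s * y ^ 2 + τ s * y ^ (k + 2) : ℝ) : ℂ)) * H y‖ ≤
      D * √(∫ y in Set.Ioi (0 : ℝ), ‖H y‖ ^ 2) := by
  obtain ⟨C, hC0, hC⟩ := exists_norm_integral_exp_mul_sq_add_rpow_le hk
  set G : ℝ → ℝ≥0∞ :=
    (Set.Ioc (-R) R).indicator fun y => ENNReal.ofReal (C * |y| ^ (-(1 / 2) : ℝ)) with hG
  have hM : ∫⁻ y, G y ≠ ⊤ := by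
    rw [hG, lintegral_indicator measurableSet_Ioc]
    have : IntegrableOn (fun y : ℝ => C * |y| ^ (-(1 / 2) : ℝ)) (Set.Ioc (-R) R) :=
      (intervalIntegrable_abs_rpow_neg_half R).1.const_mul C
    exact this.lintegral_lt_top.ne
  refine ⟨√((∫⁻ y, G y) * ENNReal.ofReal R).toReal, Real.sqrt_nonneg _,
    fun σ hσ τ hτ H hHm hH hH2 => ?_⟩
  refine integral_norm_integral_mul_le_of_kernel (volume.restrict (Set.Ioc 0 R))
    (e := fun s y => Complex.exp (Complex.I * ((σ * s * y ^ 2 + τ s * y ^ (k + 2) : ℝ) : ℂ)))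
    ?_ (fun s y => by simp [mul_comm Complex.I, Complex.norm_exp_ofReal_mul_I, -Complex.ofReal_add])
    hHm hH hH2 ENNReal.toReal_nonneg (fun N hN => ?_)
  · unfold Function.uncurry
    have h1 : Measurable fun p : ℝ × ℝ => τ p.1 := hτ.comp measurable_fst
    fun_prop
  rw [ENNReal.ofReal_toReal (ENNReal.mul_ne_top hM ENNReal.ofReal_ne_top)]
  have hker : ∀ s s' : ℝ, s - s' ≠ 0 → ‖∫ y in Set.Ioc 0 N,
      Complex.exp (Complex.I * ((σ * s * y ^ 2 + τ s * y ^ (k + 2) : ℝ) : ℂ)) *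
      (starRingEnd ℂ) (Complex.exp
        (Complex.I * ((σ * s' * y ^ 2 + τ s' * y ^ (k + 2) : ℝ) : ℂ)))‖ₑ ≤
      ENNReal.ofReal (C * |s - s'| ^ (-(1 / 2) : ℝ)) := by
    intro s s' hss
    have hσ0 : σ ≠ 0 := fun h => by simp [h] at hσ
    have h := hC (σ * (s - s')) (τ s - τ s') N (mul_ne_zero hσ0 hss) hN
    rw [abs_mul, hσ, one_mul, intervalIntegral.integral_of_le hN] at h
    rw [← ofReal_norm]
    refine ENNReal.ofReal_le_ofReal (le_of_eq_of_le ?_ h)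
    refine congrArg norm (integral_congr_ae (ae_of_all _ fun y => ?_))
    simp only [← Complex.exp_conj, map_mul, Complex.conj_I, Complex.conj_ofReal, ← Complex.exp_add]
    congr 1
    push_cast
    ring
  have hinner : ∀ s ∈ Set.Ioc 0 R, ∫⁻ s' in Set.Ioc 0 R, ‖∫ y in Set.Ioc 0 N,
      Complex.exp (Complex.I * ((σ * s * y ^ 2 + τ s * y ^ (k + 2) : ℝ) : ℂ)) *
      (starRingEnd ℂ) (Complex.exp
        (Complex.I * ((σ * s' * y ^ 2 + τ s' * y ^ (k + 2) : ℝ) : ℂ)))‖ₑ ≤ ∫⁻ y, G y := by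
    intro s hs
    rw [← lintegral_sub_left_eq_self G s]
    refine le_trans ?_ (setLIntegral_le_lintegral (Set.Ioc 0 R) _)
    refine lintegral_mono_ae ?_
    have hne : ∀ᵐ s' ∂(volume.restrict (Set.Ioc 0 R)), s' ≠ s :=
      ae_restrict_of_ae (Measure.ae_ne volume s)
    filter_upwards [hne, ae_restrict_mem measurableSet_Ioc] with s' hs' hmem
    refine (hker s s' (sub_ne_zero.mpr hs'.symm)).trans (le_of_eq ?_)
    rw [hG, Set.indicator_of_mem]
    exact ⟨by linarith [hs.1, hmem.2], by linarith [hs.2, hmem.1]⟩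
  calc _ ≤ ∫⁻ s in Set.Ioc 0 R, ∫⁻ y, G y := setLIntegral_mono' measurableSet_Ioc hinner
    _ = (∫⁻ y, G y) * ENNReal.ofReal R := by simp

/-- Approximate maximizers of a family of functions, continuous in the parameter, can be chosen
measurably. -/
theorem exists_measurable_norm_le_add {T : ℝ → ℝ → ℂ} (hT : Continuous (Function.uncurry T))
    {B : ℝ} (hB : ∀ t s, ‖T t s‖ ≤ B) {ε : ℝ} (hε : 0 < ε) :
    ∃ τ : ℝ → ℝ, Measurable τ ∧ ∀ s t, ‖T t s‖ ≤ ‖T (τ s) s‖ + ε := by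
  classical
  set q := TopologicalSpace.denseSeq ℝ with hq
  have hbdd : ∀ s, BddAbove (Set.range fun n => ‖T (q n) s‖) := fun s =>
    ⟨B, by rintro _ ⟨n, rfl⟩; exact hB _ _⟩
  have hex : ∀ s, ∃ n, ∀ m, ‖T (q m) s‖ ≤ ‖T (q n) s‖ + ε := by
    intro s
    obtain ⟨n, hn⟩ := exists_lt_of_lt_ciSup
      (show (⨆ n, ‖T (q n) s‖) - ε < ⨆ n, ‖T (q n) s‖ by linarith)
    exact ⟨n, fun m => by linarith [le_ciSup (hbdd s) m]⟩
  have hTm : ∀ n, Measurable fun s => ‖T (q n) s‖ := fun n =>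
    (hT.comp (Continuous.prodMk_right (q n))).norm.measurable
  refine ⟨fun s => q (Nat.find (hex s)), ?_, fun s t => ?_⟩
  · refine (measurable_from_nat (f := q)).comp (measurable_find hex fun n => ?_)
    simp only [Set.ofPred_forall]
    exact MeasurableSet.iInter fun m => measurableSet_le (hTm m) ((hTm n).add_const ε)
  · have hcl : IsClosed {t | ‖T t s‖ ≤ ‖T (q (Nat.find (hex s))) s‖ + ε} :=
      isClosed_le (hT.comp (Continuous.prodMk_left s)).norm continuous_const
    have := closure_minimal (s := Set.range q)
      (by rintro _ ⟨m, rfl⟩; exact Nat.find_spec (hex s) m) hcl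
    exact this ((TopologicalSpace.denseRange_denseSeq ℝ).closure_range ▸ Set.mem_univ t)

theorem continuous_integral_sin_mul_exp_mul {g : ℝ → ℂ} (hg : IntegrableOn g (Set.Ioi 0)) (a : ℝ) :
    Continuous (Function.uncurry fun t s : ℝ => ∫ l in Set.Ioi (0 : ℝ),
      (Real.sin (l * s) : ℂ) * Complex.exp (Complex.I * ((t * l ^ a : ℝ) : ℂ)) * g l) := by
  unfold Function.uncurry
  refine continuous_of_dominated (bound := fun l => ‖g l‖) (fun p => ?_)
    (fun p => ae_of_all _ fun l => ?_) hg.norm (ae_of_all _ fun l => ?_)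
  · refine AEStronglyMeasurable.mul ?_ hg.aestronglyMeasurable
    exact Measurable.aestronglyMeasurable (by fun_prop)
  · rw [norm_mul, norm_mul, Complex.norm_real]
    refine mul_le_of_le_one_left (norm_nonneg _) (mul_le_one₀ (Real.abs_sin_le_one _)
      (norm_nonneg _) ?_)
    rw [mul_comm, Complex.norm_exp_ofReal_mul_I]
  · fun_prop

theorem norm_integral_sin_mul_exp_mul_le {g : ℝ → ℂ} (hg : IntegrableOn g (Set.Ioi 0))
    (a t s : ℝ) :
    ‖∫ l in Set.Ioi (0 : ℝ),
      (Real.sin (l * s) : ℂ) * Complex.exp (Complex.I * ((t * l ^ a : ℝ) : ℂ)) * g l‖ ≤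
      ∫ l in Set.Ioi (0 : ℝ), ‖g l‖ := by
  refine norm_integral_le_of_norm_le hg.norm (ae_of_all _ fun l => ?_)
  rw [norm_mul, norm_mul, Complex.norm_real]
  refine mul_le_of_le_one_left (norm_nonneg _) (mul_le_one₀ (Real.abs_sin_le_one _)
    (norm_nonneg _) ?_)
  rw [mul_comm, Complex.norm_exp_ofReal_mul_I]

theorem integrableOn_mul_comp_sq {g : ℝ → ℂ} (hg : IntegrableOn g (Set.Ioi 0)) :
    IntegrableOn (fun y : ℝ => (y : ℂ) * g (y ^ 2)) (Set.Ioi 0) := by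
  have h := ((integrableOn_Ioi_comp_rpow_iff (f := g) (p := 2) (by norm_num)).mpr hg).smul
    ((1 / 2 : ℝ))
  refine h.congr (ae_restrict_of_forall_mem measurableSet_Ioi fun y hy => ?_)
  simp only [Pi.smul_apply, show (2 : ℝ) - 1 = 1 by norm_num, abs_two, Real.rpow_one,
    Real.rpow_two, Complex.real_smul]
  push_cast
  ring

theorem norm_integral_sin_mul_exp_mul_le_add {g : ℝ → ℂ} (hg : IntegrableOn g (Set.Ioi 0))
    (a t s : ℝ) :
    ‖∫ l in Set.Ioi (0 : ℝ),
      (Real.sin (l * s) : ℂ) * Complex.exp (Complex.I * ((t * l ^ a : ℝ) : ℂ)) * g l‖ ≤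
      ‖∫ y in Set.Ioi (0 : ℝ), Complex.exp (Complex.I *
        ((1 * s * y ^ 2 + t * y ^ (2 * a - 2 + 2) : ℝ) : ℂ)) * ((y : ℂ) * g (y ^ 2))‖ +
      ‖∫ y in Set.Ioi (0 : ℝ), Complex.exp (Complex.I *
        ((-1 * s * y ^ 2 + t * y ^ (2 * a - 2 + 2) : ℝ) : ℂ)) * ((y : ℂ) * g (y ^ 2))‖ := by
  have hint : ∀ σ : ℝ, IntegrableOn (fun y : ℝ => Complex.exp (Complex.I *
        ((σ * s * y ^ 2 + t * y ^ (2 * a - 2 + 2) : ℝ) : ℂ)) * ((y : ℂ) * g (y ^ 2)))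
        (Set.Ioi 0) := fun σ => by
    refine (integrableOn_mul_comp_sq hg).bdd_mul (c := 1)
      (Measurable.aestronglyMeasurable (by fun_prop)) (ae_of_all _ fun y => ?_)
    rw [mul_comm, Complex.norm_exp_ofReal_mul_I]
  rw [← integral_comp_rpow_Ioi_of_pos (p := 2) (by norm_num)]
  have : ∫ y in Set.Ioi (0 : ℝ), ((2 : ℝ) * y ^ ((2 : ℝ) - 1)) •
      ((Real.sin (y ^ (2 : ℝ) * s) : ℂ) *
        Complex.exp (Complex.I * ((t * (y ^ (2 : ℝ)) ^ a : ℝ) : ℂ)) * g (y ^ (2 : ℝ))) =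
      -Complex.I * ((∫ y in Set.Ioi (0 : ℝ), Complex.exp (Complex.I *
        ((1 * s * y ^ 2 + t * y ^ (2 * a - 2 + 2) : ℝ) : ℂ)) * ((y : ℂ) * g (y ^ 2))) -
      ∫ y in Set.Ioi (0 : ℝ), Complex.exp (Complex.I *
        ((-1 * s * y ^ 2 + t * y ^ (2 * a - 2 + 2) : ℝ) : ℂ)) * ((y : ℂ) * g (y ^ 2))) := by
    rw [← integral_sub (hint 1) (hint (-1)), ← integral_const_mul]
    refine setIntegral_congr_fun measurableSet_Ioi fun y hy => ?_
    have hy0 : (0 : ℝ) ≤ y := le_of_lt hy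
    rw [← Real.rpow_mul hy0]
    simp only [show (2 : ℝ) - 1 = 1 by norm_num, Real.rpow_one,
      Real.rpow_two, sub_add_cancel, Complex.ofReal_add, mul_add, Complex.exp_add,
      Complex.real_smul, Complex.ofReal_sin, Complex.sin]
    push_cast
    rw [show Complex.I * (1 * s * y ^ 2) = (y : ℂ) ^ 2 * s * Complex.I by ring,
      show Complex.I * (-1 * s * y ^ 2) = -((y : ℂ) ^ 2 * s) * Complex.I by ring]
    ring
  rw [this, norm_mul, norm_neg, Complex.norm_I, one_mul]
  exact norm_sub_le _ _

theorem integrableOn_sobolev_density (F : 𝓢(ℝ, ℂ)) :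
    IntegrableOn (fun l : ℝ => (1 + l ^ 2) ^ ((1 : ℝ) / 4) * ‖F l‖ ^ 2 * l ^ 2) (Set.Ioi 0) := by
  obtain ⟨C, -, hC⟩ := F.decay 0 0
  simp only [pow_zero, one_mul, norm_iteratedFDeriv_zero] at hC
  have h := (((F.integrable_pow_mul volume 2).add (F.integrable_pow_mul volume 4)).const_mul
    C).integrableOn (s := Set.Ioi 0)
  refine h.mono' ?_ (ae_of_all _ fun l => ?_)
  · have hF : Measurable fun l : ℝ => F l := F.continuous.measurable
    exact Measurable.aestronglyMeasurable (by fun_prop)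
  · have h1 : (1 : ℝ) ≤ 1 + l ^ 2 := by linarith [sq_nonneg l]
    have h2 : (1 + l ^ 2) ^ ((1 : ℝ) / 4) ≤ 1 + l ^ 2 :=
      Real.rpow_le_self_of_one_le h1 (by norm_num)
    rw [Real.norm_of_nonneg (by positivity)]
    calc (1 + l ^ 2) ^ ((1 : ℝ) / 4) * ‖F l‖ ^ 2 * l ^ 2
        ≤ (1 + l ^ 2) * (C * ‖F l‖) * l ^ 2 := by
          gcongr
          rw [sq]
          gcongr
          exact hC l
      _ = C * (|l| ^ 2 * ‖F l‖ + |l| ^ 4 * ‖F l‖) := by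
          rw [sq_abs, show |l| ^ 4 = (|l| ^ 2) ^ 2 by ring, sq_abs]
          ring

theorem integrableOn_sq_and_integral_sq_le (F : 𝓢(ℝ, ℂ)) :
    IntegrableOn (fun y : ℝ => ‖(y : ℂ) * (((y ^ 2 : ℝ) : ℂ) * F (y ^ 2))‖ ^ 2) (Set.Ioi 0) ∧
    ∫ y in Set.Ioi (0 : ℝ), ‖(y : ℂ) * (((y ^ 2 : ℝ) : ℂ) * F (y ^ 2))‖ ^ 2 ≤
      ∫ l in Set.Ioi (0 : ℝ), (1 + l ^ 2) ^ ((1 : ℝ) / 4) * ‖F l‖ ^ 2 * l ^ 2 := by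
  have hW := integrableOn_sobolev_density F
  have hle : ∀ l ∈ Set.Ioi (0 : ℝ), 1 / 2 * l ^ ((1 : ℝ) / 2) * ‖(l : ℂ) * F l‖ ^ 2 ≤
      (1 + l ^ 2) ^ ((1 : ℝ) / 4) * ‖F l‖ ^ 2 * l ^ 2 := by
    intro l hl
    have hl0 : (0 : ℝ) < l := hl
    have h1 : l ^ ((1 : ℝ) / 2) ≤ (1 + l ^ 2) ^ ((1 : ℝ) / 4) := by
      rw [show (1 : ℝ) / 2 = 2 * (1 / 4) by norm_num, Real.rpow_mul hl0.le, Real.rpow_two]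
      gcongr
      linarith
    have h2 : 0 ≤ l ^ ((1 : ℝ) / 2) := by positivity
    rw [norm_mul, Complex.norm_real, Real.norm_of_nonneg hl0.le, mul_pow, mul_comm (l ^ 2),
      ← mul_assoc]
    gcongr
    linarith
  have hI : IntegrableOn (fun l : ℝ => 1 / 2 * l ^ ((1 : ℝ) / 2) * ‖(l : ℂ) * F l‖ ^ 2)
      (Set.Ioi 0) := by
    refine hW.mono' ?_ (ae_restrict_of_forall_mem measurableSet_Ioi fun l hl => ?_)
    · have hF : Measurable fun l : ℝ => F l := F.continuous.measurable
      exact Measurable.aestronglyMeasurable (by fun_prop)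
    · have hl0 : (0 : ℝ) < l := hl
      rw [Real.norm_of_nonneg (by positivity)]
      exact hle l hl
  have hsub : ∀ y ∈ Set.Ioi (0 : ℝ), ((2 : ℝ) * y ^ ((2 : ℝ) - 1)) •
      (1 / 2 * (y ^ (2 : ℝ)) ^ ((1 : ℝ) / 2) * ‖((y ^ (2 : ℝ) : ℝ) : ℂ) * F (y ^ (2 : ℝ))‖ ^ 2) =
      ‖(y : ℂ) * (((y ^ 2 : ℝ) : ℂ) * F (y ^ 2))‖ ^ 2 := by
    intro y hy
    have hy0 : (0 : ℝ) < y := hy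
    rw [← Real.rpow_mul hy0.le, show (2 : ℝ) * (1 / 2) = 1 by norm_num,
      show (2 : ℝ) - 1 = 1 by norm_num, Real.rpow_one, Real.rpow_two, norm_mul (y : ℂ),
      Complex.norm_real, Real.norm_of_nonneg hy0.le, smul_eq_mul]
    ring
  refine ⟨?_, ?_⟩
  · have h := (integrableOn_Ioi_comp_rpow_iff (p := 2) _ (by norm_num)).mpr hI
    rw [abs_two] at h
    exact h.congr_fun hsub measurableSet_Ioi
  · rw [← setIntegral_congr_fun measurableSet_Ioi hsub,
      integral_comp_rpow_Ioi_of_pos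
        (g := fun l => 1 / 2 * l ^ ((1 : ℝ) / 2) * ‖(l : ℂ) * F l‖ ^ 2) (by norm_num)]
    exact setIntegral_mono_on hI hW measurableSet_Ioi hle

theorem iSup_norm_mul_sinh_sq_le {F : ℝ → ℂ} {a s M : ℝ} (hs : 0 < s)
    (hM : ∀ t : ℝ, ‖∫ l in Set.Ioi (0 : ℝ), (Real.sin (l * s) : ℂ) *
      Complex.exp (Complex.I * ((t * l ^ a : ℝ) : ℂ)) * ((l : ℂ) * F l)‖ ≤ M) :
    (⨆ t ∈ Set.Ioo (0 : ℝ) 1, ‖∫ l in Set.Ioi (0 : ℝ),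
      ((Real.sin (l * s) / (l * Real.sinh s) : ℝ) : ℂ) *
        Complex.exp (Complex.I * ((t * l ^ a : ℝ) : ℂ)) * F l * (l : ℂ) ^ 2‖) * Real.sinh s ^ 2 ≤
      M * Real.sinh s := by
  have hsinh : 0 < Real.sinh s := Real.sinh_pos_iff.mpr hs
  have hM0 : 0 ≤ M := (norm_nonneg _).trans (hM 0)
  have hsup : (⨆ t ∈ Set.Ioo (0 : ℝ) 1, ‖∫ l in Set.Ioi (0 : ℝ),
      ((Real.sin (l * s) / (l * Real.sinh s) : ℝ) : ℂ) *
        Complex.exp (Complex.I * ((t * l ^ a : ℝ) : ℂ)) * F l * (l : ℂ) ^ 2‖) ≤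
      (Real.sinh s)⁻¹ * M := by
    refine Real.iSup_le (fun t => Real.iSup_le (fun _ => ?_) (by positivity)) (by positivity)
    have : ∫ l in Set.Ioi (0 : ℝ), ((Real.sin (l * s) / (l * Real.sinh s) : ℝ) : ℂ) *
        Complex.exp (Complex.I * ((t * l ^ a : ℝ) : ℂ)) * F l * (l : ℂ) ^ 2 =
        (((Real.sinh s)⁻¹ : ℝ) : ℂ) * ∫ l in Set.Ioi (0 : ℝ), (Real.sin (l * s) : ℂ) *
          Complex.exp (Complex.I * ((t * l ^ a : ℝ) : ℂ)) * ((l : ℂ) * F l) := by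
      rw [← integral_const_mul]
      refine setIntegral_congr_fun measurableSet_Ioi fun l hl => ?_
      have hl0 : (l : ℂ) ≠ 0 := Complex.ofReal_ne_zero.mpr (ne_of_gt hl)
      have hs0 : ((Real.sinh s : ℝ) : ℂ) ≠ 0 := Complex.ofReal_ne_zero.mpr hsinh.ne'
      simp only [Complex.ofReal_div, Complex.ofReal_mul, Complex.ofReal_inv]
      field_simp
    rw [this, norm_mul, Complex.norm_real, Real.norm_of_nonneg (by positivity)]
    gcongr
    exact hM t
  calc _ ≤ (Real.sinh s)⁻¹ * M * Real.sinh s ^ 2 := by gcongr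
    _ = M * Real.sinh s := by field_simp

theorem integrableOn_mul_schwartz (F : 𝓢(ℝ, ℂ)) :
    IntegrableOn (fun l : ℝ => (l : ℂ) * F l) (Set.Ioi 0) := by
  refine (F.integrable_pow_mul volume 1).integrableOn.mono'
    (Continuous.aestronglyMeasurable (by fun_prop)) (ae_of_all _ fun l => ?_)
  simp

/-- Maximal estimate for the radial propagator with a measurable choice of times. -/
theorem exists_integral_norm_integral_sin_le {a : ℝ} (ha : 1 < a) (R : ℝ) :
    ∃ D : ℝ, 0 ≤ D ∧ ∀ τ : ℝ → ℝ, Measurable τ → ∀ F : 𝓢(ℝ, ℂ),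
      ∫ s in Set.Ioc 0 R, ‖∫ l in Set.Ioi (0 : ℝ), (Real.sin (l * s) : ℂ) *
        Complex.exp (Complex.I * ((τ s * l ^ a : ℝ) : ℂ)) * ((l : ℂ) * F l)‖ ≤
      D * √(∫ l in Set.Ioi (0 : ℝ), (1 + l ^ 2) ^ ((1 : ℝ) / 4) * ‖F l‖ ^ 2 * l ^ 2) := by
  obtain ⟨D, hD0, hD⟩ := exists_integral_norm_linearized_le (k := 2 * a - 2) (R := R) (by linarith)
  refine ⟨2 * D, by positivity, fun τ hτ F => ?_⟩
  have hg := integrableOn_mul_schwartz F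
  obtain ⟨hH2, hle⟩ := integrableOn_sq_and_integral_sq_le F
  have hFm : Measurable fun l : ℝ => F l := F.continuous.measurable
  have hHm : Measurable fun y : ℝ => (y : ℂ) * (((y ^ 2 : ℝ) : ℂ) * F (y ^ 2)) := by fun_prop
  have hH := integrableOn_mul_comp_sq hg
  have hint : ∀ σ : ℝ, IntegrableOn (fun s => ‖∫ y in Set.Ioi (0 : ℝ),
      Complex.exp (Complex.I * ((σ * s * y ^ 2 + τ s * y ^ (2 * a - 2 + 2) : ℝ) : ℂ)) *
        ((y : ℂ) * (((y ^ 2 : ℝ) : ℂ) * F (y ^ 2)))‖) (Set.Ioc 0 R) := by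
    intro σ
    have hm : Measurable fun p : ℝ × ℝ => Complex.exp (Complex.I *
        ((σ * p.1 * p.2 ^ 2 + τ p.1 * p.2 ^ (2 * a - 2 + 2) : ℝ) : ℂ)) *
        ((p.2 : ℂ) * (((p.2 ^ 2 : ℝ) : ℂ) * F (p.2 ^ 2))) := by
      have h1 : Measurable fun p : ℝ × ℝ => τ p.1 := hτ.comp measurable_fst
      fun_prop
    refine Integrable.of_bound
      hm.stronglyMeasurable.integral_prod_right'.norm.aestronglyMeasurable
      (∫ y in Set.Ioi (0 : ℝ), ‖(y : ℂ) * (((y ^ 2 : ℝ) : ℂ) * F (y ^ 2))‖)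
      (ae_of_all _ fun s => ?_)
    rw [norm_norm]
    refine norm_integral_le_of_norm_le hH.norm (ae_of_all _ fun y => ?_)
    rw [norm_mul, mul_comm Complex.I, Complex.norm_exp_ofReal_mul_I, one_mul]
  calc _ ≤ _ := integral_mono_of_nonneg (ae_of_all _ fun s => norm_nonneg _)
        ((hint 1).add (hint (-1)))
        (ae_of_all _ fun s => norm_integral_sin_mul_exp_mul_le_add hg a (τ s) s)
    _ = _ := integral_add (hint 1) (hint (-1))
    _ ≤ _ := add_le_add (hD 1 (by simp) τ hτ _ hHm hH hH2) (hD (-1) (by simp) τ hτ _ hHm hH hH2)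
    _ ≤ _ := by
      rw [← two_mul, ← mul_assoc]
      gcongr

/-- **Maximal inequality on ℍ³ for the fractional Schrödinger equation (shifted Laplacian).**
Let `a > 1`. For every `R > 0` there is `c > 0` such that for every even Schwartz
`F : ℝ → ℂ`:
`∫_0^R sup_{0<t<1} |∫_0^∞ (sin(λs)/(λ sinh s)) e^{itλᵃ} F(λ) λ² dλ| sinh²(s) ds
  ≤ c (∫_0^∞ (1+λ²)^{1/4} |F(λ)|² λ² dλ)^{1/2}`. -/
theorem hyperbolic_fractional_maximal_inequality
    (a : ℝ) (ha : 1 < a) (R : ℝ) (hR : 0 < R) :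
    ∃ c : ℝ, 0 < c ∧ ∀ F : 𝓢(ℝ, ℂ), (∀ x : ℝ, F (-x) = F x) →
      (∫⁻ s in Set.Ioc (0:ℝ) R,
          ENNReal.ofReal ((⨆ t ∈ Set.Ioo (0:ℝ) 1,
              ‖∫ l in Set.Ioi (0:ℝ),
                  ((Real.sin (l * s) / (l * Real.sinh s) : ℝ) : ℂ) *
                    Complex.exp (Complex.I * ((t * l ^ a : ℝ) : ℂ)) *
                    F l * ((l : ℂ)) ^ 2‖) *
            Real.sinh s ^ 2))
        ≤ ENNReal.ofReal (c *
            (∫ l in Set.Ioi (0:ℝ), (1 + l ^ 2) ^ ((1:ℝ)/4) * ‖F l‖ ^ 2 * l ^ 2)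
              ^ ((1:ℝ)/2)) := by
  obtain ⟨D, hD0, hD⟩ := exists_integral_norm_integral_sin_le ha R
  have hsR : 0 < Real.sinh R := Real.sinh_pos_iff.mpr hR
  refine ⟨D * Real.sinh R + 1, by positivity, fun F _ => ?_⟩
  rw [← Real.sqrt_eq_rpow]
  set X := ∫ l in Set.Ioi (0 : ℝ), (1 + l ^ 2) ^ ((1 : ℝ) / 4) * ‖F l‖ ^ 2 * l ^ 2
  have hg := integrableOn_mul_schwartz F
  set T : ℝ → ℝ → ℂ := fun t s => ∫ l in Set.Ioi (0 : ℝ),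
    (Real.sin (l * s) : ℂ) * Complex.exp (Complex.I * ((t * l ^ a : ℝ) : ℂ)) * ((l : ℂ) * F l)
  have hT : Continuous (Function.uncurry T) := continuous_integral_sin_mul_exp_mul hg a
  have hTb : ∀ t s, ‖T t s‖ ≤ ∫ l in Set.Ioi (0 : ℝ), ‖(l : ℂ) * F l‖ :=
    norm_integral_sin_mul_exp_mul_le hg a
  refine ENNReal.le_of_forall_pos_le_add fun ε hε _ => ?_
  set δ : ℝ := ε / (R * Real.sinh R) with hδ
  have hδ0 : 0 < δ := by positivity
  obtain ⟨τ, hτ, hmax⟩ := exists_measurable_norm_le_add hT hTb hδ0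
  have hint : IntegrableOn (fun s => ‖T (τ s) s‖) (Set.Ioc 0 R) :=
    Integrable.of_bound (hT.measurable.comp (hτ.prodMk measurable_id)).norm.aestronglyMeasurable
      (∫ l in Set.Ioi (0 : ℝ), ‖(l : ℂ) * F l‖) (ae_of_all _ fun s => by simpa using hTb (τ s) s)
  have hint' : IntegrableOn (fun s => (‖T (τ s) s‖ + δ) * Real.sinh R) (Set.Ioc 0 R) :=
    (hint.add (integrableOn_const (by simp))).mul_const _
  calc _ ≤ ∫⁻ s in Set.Ioc 0 R, ENNReal.ofReal ((‖T (τ s) s‖ + δ) * Real.sinh R) := by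
        refine setLIntegral_mono' measurableSet_Ioc fun s hs => ENNReal.ofReal_le_ofReal ?_
        refine (iSup_norm_mul_sinh_sq_le hs.1 (hmax s)).trans ?_
        gcongr
        exact Real.sinh_le_sinh.mpr hs.2
    _ = ENNReal.ofReal (((∫ s in Set.Ioc 0 R, ‖T (τ s) s‖) + R * δ) * Real.sinh R) := by
        rw [← ofReal_integral_eq_lintegral_ofReal hint' (ae_of_all _ fun s => by positivity),
          integral_mul_const, integral_add hint (integrableOn_const (by simp))]
        simp [hR.le]
    _ ≤ ENNReal.ofReal ((D * Real.sinh R + 1) * √X + ε) := by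
        refine ENNReal.ofReal_le_ofReal ?_
        have h := mul_le_mul_of_nonneg_right (hD τ hτ F) hsR.le
        have h2 : R * δ * Real.sinh R = ε := by rw [hδ]; field_simp
        rw [add_mul, h2]
        linarith [Real.sqrt_nonneg X]
    _ ≤ ENNReal.ofReal ((D * Real.sinh R + 1) * √X) + ε := by
        refine ENNReal.ofReal_add_le.trans (le_of_eq ?_)
        rw [ENNReal.ofReal_coe_nnreal]
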